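/- arXiv:1302.1414 — 2 statements merged into one kernel-verified Lean document; each statement's English description precedes it below -/
import Mathlib

section
/- Assume R_0 R_1 < 1. Then for any γ_1 > 0 there exist δ_1 ∈ (0,δ_0] and c_1 > 0 such that for all λ ∈ [−δ_1,δ_1] and all ω ∈ [−γ_1,γ_1]: the operator I − C(λ,ω) is an isomorphism on C_n as well as on C_n^1, and ‖(I−C(λ,ω))^{−1}‖_{L(C_n)} + ‖(I−C(λ,ω))^{−1}‖_{L(C_n^1)} ≤ c_1. -/
open Real Set MeasureTheory Filter Topology

noncomputable section

instance fact_two_pi_pos : Fact (0 < 2 * Real.pi) := ⟨by positivity⟩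

/-- The time circle of length `2π` (continuous `2π`-time-periodic functions of `t ∈ ℝ`
are identified with continuous functions on this circle). -/
abbrev TimeCircle : Type := AddCircle (2 * Real.pi)

/-- The domain `[0,1] × (ℝ / 2πℤ)`. -/
abbrev Dom : Type := Set.Icc (0:ℝ) 1 × TimeCircle

/-- The Banach space `C_n` of continuous `2π`-time-periodic maps `u : [0,1] × ℝ → ℝⁿ`
with the sup-norm, realized as the space of continuous maps on the compact set `Dom`. -/
abbrev Cspace (n : ℕ) : Type := C(Dom, Fin n → ℝ)

/-- Evaluation of an element of `Cspace n` at real coordinates `(x,t)`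
(extended constantly outside `[0,1]` in the `x`-variable). -/
def ev {n : ℕ} (u : Cspace n) (x t : ℝ) : Fin n → ℝ :=
  u (Set.projIcc (0:ℝ) 1 zero_le_one x, (t : TimeCircle))

/-- The boundary point `x_j`: `0` for `j = 1,…,m` and `1` for `j = m+1,…,n`
(with 0-based indices: `0` for `j < m`, `1` for `j ≥ m`). -/
def xjv (m : ℕ) {n : ℕ} (j : Fin n) : ℝ := if (j : ℕ) < m then 0 else 1

/-- The data of the problem: coefficients `a_j(x,λ)`, nonlinearities `b_j(x,λ,u)`
and reflection coefficients `r_{jk}`, for a system of `n` equations with `m`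
components running to the right. -/
structure HypData (n m : ℕ) where
  a : Fin n → ℝ → ℝ → ℝ
  b : Fin n → ℝ → ℝ → (Fin n → ℝ) → ℝ
  r : Fin n → Fin n → ℝ

namespace HypData

variable {n m : ℕ} (d : HypData n m)

/-- `∂_{u_k} b_j (x, λ, 0)`. -/
def dbu (j k : Fin n) (x lam : ℝ) : ℝ := fderiv ℝ (d.b j x lam) 0 (Pi.single k 1)

/-- `∂²_{u_k u_l} b_j (x, λ, 0)`. -/
def dbu2 (j k l : Fin n) (x lam : ℝ) : ℝ :=
  fderiv ℝ (fun v => fderiv ℝ (d.b j x lam) v (Pi.single l 1)) 0 (Pi.single k 1)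

/-- `∂³_{u_k u_l u_r} b_j (x, λ, 0)`. -/
def dbu3 (j k l rr : Fin n) (x lam : ℝ) : ℝ :=
  fderiv ℝ (fun v =>
    fderiv ℝ (fun v' => fderiv ℝ (d.b j x lam) v' (Pi.single rr 1)) v (Pi.single l 1))
    0 (Pi.single k 1)

/-- The characteristic `τ_j(ξ,x,t,λ,ω) = ω ∫_x^ξ dη / a_j(η,λ) + t`. -/
def tau (j : Fin n) (ξ x t lam ω : ℝ) : ℝ := ω * (∫ η in x..ξ, (d.a j η lam)⁻¹) + t

/-- The weight `c_j(ξ,x,λ) = exp ∫_x^ξ ∂_{u_j}b_j(η,λ,0) / a_j(η,λ) dη`. -/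
def cfac (j : Fin n) (ξ x lam : ℝ) : ℝ :=
  Real.exp (∫ η in x..ξ, d.dbu j j η lam / d.a j η lam)

/-- `f_j(x,λ,u) = ∂_{u_j}b_j(x,λ,0) u_j − b_j(x,λ,u)`. -/
def ffun (j : Fin n) (x lam : ℝ) (u : Fin n → ℝ) : ℝ := d.dbu j j x lam * u j - d.b j x lam u

/-- The operator `C(λ,ω)` acting on (representations of) functions. -/
def CopRaw (lam ω : ℝ) (U : ℝ → ℝ → Fin n → ℝ) (x t : ℝ) (j : Fin n) : ℝ :=
  if (j : ℕ) < m then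
    d.cfac j 0 x lam *
      ∑ k : Fin n, (if m ≤ (k : ℕ) then d.r j k * U 0 (d.tau j 0 x t lam ω) k else 0)
  else
    d.cfac j 1 x lam *
      ∑ k : Fin n, (if (k : ℕ) < m then d.r j k * U 1 (d.tau j 1 x t lam ω) k else 0)

/-- The operator `F(λ,ω,·)` acting on (representations of) functions. -/
def FopRaw (lam ω : ℝ) (U : ℝ → ℝ → Fin n → ℝ) (x t : ℝ) (j : Fin n) : ℝ :=
  ∫ ξ in (xjv m j)..x,
    (d.cfac j ξ x lam / d.a j ξ lam) * d.ffun j ξ lam (U ξ (d.tau j ξ x t lam ω))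

/-- The operator `D(λ,ω)`. -/
def DopRaw (lam ω : ℝ) (U : ℝ → ℝ → Fin n → ℝ) (x t : ℝ) (j : Fin n) : ℝ :=
  ∫ ξ in (xjv m j)..x,
    (d.cfac j ξ x lam / d.a j ξ lam) * U ξ (d.tau j ξ x t lam ω) j

/-- The Fréchet derivative `∂_u F(λ,ω,0)` (explicit formula). -/
def dFRaw (lam ω : ℝ) (U : ℝ → ℝ → Fin n → ℝ) (x t : ℝ) (j : Fin n) : ℝ :=
  -∫ ξ in (xjv m j)..x,
    (d.cfac j ξ x lam / d.a j ξ lam) *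
      ∑ k : Fin n, (if k ≠ j then d.dbu j k ξ lam * U ξ (d.tau j ξ x t lam ω) k else 0)

end HypData

/-- Partial derivative in `x` (within `[0,1]`). -/
def pdx {n : ℕ} (U : ℝ → ℝ → Fin n → ℝ) (x t : ℝ) (j : Fin n) : ℝ :=
  derivWithin (fun y => U y t j) (Set.Icc 0 1) x

/-- Partial derivative in `t`. -/
def pdt {n : ℕ} (U : ℝ → ℝ → Fin n → ℝ) (x t : ℝ) (j : Fin n) : ℝ :=
  deriv (fun s => U x s j) t

/-- `U` represents an element of `C_n`: continuous on `[0,1] × ℝ` and `2π`-periodic in time. -/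
def IsCnFun {n : ℕ} (U : ℝ → ℝ → Fin n → ℝ) : Prop :=
  ContinuousOn (fun p : ℝ × ℝ => U p.1 p.2) (Set.Icc 0 1 ×ˢ Set.univ) ∧
  ∀ x t, U x (t + 2 * Real.pi) = U x t

/-- `U` represents an element of `C_n^1`: it is in `C_n` and has continuous
partial derivatives `∂_x U`, `∂_t U` on `[0,1] × ℝ`. -/
def IsCn1Fun {n : ℕ} (U : ℝ → ℝ → Fin n → ℝ) : Prop :=
  IsCnFun U ∧
  (∀ (j : Fin n) (t : ℝ), ∀ x ∈ Set.Icc (0:ℝ) 1,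
      DifferentiableWithinAt ℝ (fun y => U y t j) (Set.Icc 0 1) x ∧
      DifferentiableAt ℝ (fun s => U x s j) t) ∧
  ContinuousOn (fun p : ℝ × ℝ => pdx U p.1 p.2) (Set.Icc 0 1 ×ˢ Set.univ) ∧
  ContinuousOn (fun p : ℝ × ℝ => pdt U p.1 p.2) (Set.Icc 0 1 ×ˢ Set.univ)

/-- The sup-norm `‖U‖_∞ = sup { |U_j(x,t)| : x ∈ [0,1], t ∈ ℝ, j }`. -/
def supNorm {n : ℕ} (U : ℝ → ℝ → Fin n → ℝ) : ℝ :=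
  sSup {y : ℝ | ∃ x ∈ Set.Icc (0:ℝ) 1, ∃ t : ℝ, ∃ j : Fin n, y = |U x t j|}

/-- The `C¹`-norm `‖U‖_∞ + ‖∂_x U‖_∞ + ‖∂_t U‖_∞`. -/
def c1Norm {n : ℕ} (U : ℝ → ℝ → Fin n → ℝ) : ℝ :=
  supNorm U + supNorm (pdx U) + supNorm (pdt U)

/-- The `L²`-type pairing `⟨u,v⟩ = (1/2π) Σ_j ∫_0^{2π} ∫_0^1 u_j v_j dx dt`. -/
def pairing {n : ℕ} (U V : ℝ → ℝ → Fin n → ℝ) : ℝ :=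
  (1 / (2 * Real.pi)) *
    ∑ j : Fin n, ∫ t in (0:ℝ)..(2 * Real.pi), ∫ x in (0:ℝ)..1, U x t j * V x t j

/-- The Hermitian pairing `⟨u,v⟩ = (1/2π) Σ_j ∫_0^{2π} ∫_0^1 u_j conj(v_j) dx dt`. -/
def pairingC {n : ℕ} (U : ℝ → ℝ → Fin n → ℝ) (V : ℝ → ℝ → Fin n → ℂ) : ℂ :=
  (1 / (2 * Real.pi) : ℂ) *
    ∑ j : Fin n, ∫ t in (0:ℝ)..(2 * Real.pi), ∫ x in (0:ℝ)..1,
      (U x t j : ℂ) * starRingEnd ℂ (V x t j)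

/-- The real part of the wave `v(x) e^{-it}`. -/
def reWave {n : ℕ} (v : Fin n → ℝ → ℂ) (x t : ℝ) (j : Fin n) : ℝ :=
  (v j x * Complex.exp (-(Complex.I * t))).re

/-- The imaginary part of the wave `v(x) e^{-it}`. -/
def imWave {n : ℕ} (v : Fin n → ℝ → ℂ) (x t : ℝ) (j : Fin n) : ℝ :=
  (v j x * Complex.exp (-(Complex.I * t))).im

/-- A family of complex functions on `[0,1]` is nontrivial. -/
def Nontriv {n : ℕ} (v : Fin n → ℝ → ℂ) : Prop := ∃ j : Fin n, ∃ x ∈ Set.Icc (0:ℝ) 1, v j x ≠ 0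

/-- The time shift operator `(S_φ u)(x,t) = u(x, t+φ)` on `Cspace n`. -/
def Sshift {n : ℕ} (φ : ℝ) (u : Cspace n) : Cspace n :=
  u.comp ⟨fun p => (p.1, p.2 + (φ : TimeCircle)), by continuity⟩

namespace HypData

variable {n m : ℕ} (d : HypData n m)

/-- The differential operator `A(λ,ω)`. -/
def AopRaw (lam ω : ℝ) (U : ℝ → ℝ → Fin n → ℝ) (x t : ℝ) (j : Fin n) : ℝ :=
  ω * pdt U x t j + d.a j x lam * pdx U x t j + d.dbu j j x lam * U x t j

/-- The formally adjoint differential operator `Ã(λ,ω)`. -/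
def AtilRaw (lam ω : ℝ) (U : ℝ → ℝ → Fin n → ℝ) (x t : ℝ) (j : Fin n) : ℝ :=
  -(ω * pdt U x t j) - derivWithin (fun y => d.a j y lam * U y t j) (Set.Icc 0 1) x +
    d.dbu j j x lam * U x t j

/-- The complex version of `Ã(λ,ω)` acting on complex-valued functions. -/
def AtilRawC (lam ω : ℝ) (W : ℝ → ℝ → Fin n → ℂ) (x t : ℝ) (j : Fin n) : ℂ :=
  -((ω : ℂ) * deriv (fun s => W x s j) t) -
    derivWithin (fun y => (d.a j y lam : ℂ) * W y t j) (Set.Icc 0 1) x +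
    (d.dbu j j x lam : ℂ) * W x t j

/-- The off-diagonal multiplication operator `B(λ)`. -/
def BopRaw (lam : ℝ) (U : ℝ → ℝ → Fin n → ℝ) (x t : ℝ) (j : Fin n) : ℝ :=
  ∑ k : Fin n, (if k ≠ j then d.dbu j k x lam * U x t k else 0)

/-- The reflection boundary conditions. -/
def SatBC (U : ℝ → ℝ → Fin n → ℝ) : Prop :=
  ∀ (t : ℝ) (j : Fin n),
    ((j : ℕ) < m → U 0 t j = ∑ k : Fin n, (if m ≤ (k : ℕ) then d.r j k * U 0 t k else 0)) ∧
    (m ≤ (j : ℕ) → U 1 t j = ∑ k : Fin n, (if (k : ℕ) < m then d.r j k * U 1 t k else 0))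

/-- The adjoint boundary conditions. -/
def SatAdjBC (lam : ℝ) (V : ℝ → ℝ → Fin n → ℝ) : Prop :=
  ∀ (t : ℝ) (j : Fin n),
    (m ≤ (j : ℕ) → d.a j 0 lam * V 0 t j
        = -∑ k : Fin n, (if (k : ℕ) < m then d.r k j * d.a k 0 lam * V 0 t k else 0)) ∧
    ((j : ℕ) < m → d.a j 1 lam * V 1 t j
        = -∑ k : Fin n, (if m ≤ (k : ℕ) then d.r k j * d.a k 1 lam * V 1 t k else 0))

/-- `U` is a classical (`C¹`, `2π`-time-periodic) solution of the hyperbolic system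
`ω ∂_t u_j + a_j(x,λ) ∂_x u_j + b_j(x,λ,u) = 0` with the reflection boundary conditions. -/
def IsClassicalSolution (lam ω : ℝ) (U : ℝ → ℝ → Fin n → ℝ) : Prop :=
  IsCn1Fun U ∧
  (∀ x ∈ Set.Ioo (0:ℝ) 1, ∀ (t : ℝ) (j : Fin n),
      ω * pdt U x t j + d.a j x lam * pdx U x t j + d.b j x lam (U x t) = 0) ∧
  d.SatBC U

/-- The standing assumptions: `1 ≤ m ≤ n`, smoothness of the coefficients, hyperbolicity
`a_j(x,0) ≠ 0`, nondegeneracy `a_j(x,0) ≠ a_k(x,0)` for `j ≠ k`, the trivial solution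
assumption `b_j(x,λ,0) = 0`, and nonvanishing of `a_j(x,λ)` for `|λ| ≤ δ₀`. -/
def StandingHyps (δ0 : ℝ) : Prop :=
  1 ≤ m ∧ m ≤ n ∧
  (∀ j, ContDiff ℝ (⊤ : ℕ∞) (fun p : ℝ × ℝ => d.a j p.1 p.2)) ∧
  (∀ j, ContDiff ℝ (⊤ : ℕ∞) (fun p : ℝ × ℝ × (Fin n → ℝ) => d.b j p.1 p.2.1 p.2.2)) ∧
  (∀ j, ∀ x ∈ Set.Icc (0:ℝ) 1, d.a j x 0 ≠ 0) ∧
  (∀ j k, j ≠ k → ∀ x ∈ Set.Icc (0:ℝ) 1, d.a j x 0 ≠ d.a k x 0) ∧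
  (∀ j x lam, d.b j x lam 0 = 0) ∧
  0 < δ0 ∧
  (∀ j, ∀ x ∈ Set.Icc (0:ℝ) 1, ∀ lam ∈ Set.Icc (-δ0) δ0, d.a j x lam ≠ 0)

/-- The constant `R₀(λ)`. -/
def R0lam (lam : ℝ) : ℝ :=
  sSup {y : ℝ | ∃ j : Fin n, (j : ℕ) < m ∧ ∃ x ∈ Set.Icc (0:ℝ) 1,
    y = ∑ k : Fin n, (if m ≤ (k : ℕ) then
          |d.r j k| * Real.exp (-∫ η in (0:ℝ)..x, d.dbu j j η lam / d.a j η lam) else 0)}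

/-- The constant `R₁(λ)`. -/
def R1lam (lam : ℝ) : ℝ :=
  sSup {y : ℝ | ∃ j : Fin n, m ≤ (j : ℕ) ∧ ∃ x ∈ Set.Icc (0:ℝ) 1,
    y = ∑ k : Fin n, (if (k : ℕ) < m then
          |d.r j k| * Real.exp (∫ η in x..(1:ℝ), d.dbu j j η lam / d.a j η lam) else 0)}

/-- `R₀ = R₀(0)`. -/
def R0c : ℝ := d.R0lam 0

/-- `R₁ = R₁(0)`. -/
def R1c : ℝ := d.R1lam 0

/-- `v` solves the eigenvalue problem (EV) with parameters `λ`, `μ`. -/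
def IsEV (lam : ℝ) (mu : ℂ) (v : Fin n → ℝ → ℂ) : Prop :=
  (∀ (j : Fin n), ∀ x ∈ Set.Icc (0:ℝ) 1, ∃ dv : ℂ,
      HasDerivWithinAt (v j) dv (Set.Icc 0 1) x ∧
      (d.a j x lam : ℂ) * dv + ∑ k : Fin n, (d.dbu j k x lam : ℂ) * v k x = mu * v j x) ∧
  (∀ j : Fin n, (j : ℕ) < m →
      v j 0 = ∑ k : Fin n, (if m ≤ (k : ℕ) then (d.r j k : ℂ) * v k 0 else 0)) ∧
  (∀ j : Fin n, m ≤ (j : ℕ) →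
      v j 1 = ∑ k : Fin n, (if (k : ℕ) < m then (d.r j k : ℂ) * v k 1 else 0))

/-- `w` solves the adjoint eigenvalue problem (AEV) with parameters `λ`, `ν`. -/
def IsAEV (lam : ℝ) (nu : ℂ) (w : Fin n → ℝ → ℂ) : Prop :=
  (∀ (j : Fin n), ∀ x ∈ Set.Icc (0:ℝ) 1, ∃ dw : ℂ,
      HasDerivWithinAt (fun y => (d.a j y lam : ℂ) * w j y) dw (Set.Icc 0 1) x ∧
      -dw + ∑ k : Fin n, (d.dbu k j x lam : ℂ) * w k x = nu * w j x) ∧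
  (∀ j : Fin n, m ≤ (j : ℕ) →
      (d.a j 0 lam : ℂ) * w j 0
        = -∑ k : Fin n, (if (k : ℕ) < m then (d.r k j : ℂ) * (d.a k 0 lam : ℂ) * w k 0 else 0)) ∧
  (∀ j : Fin n, (j : ℕ) < m →
      (d.a j 1 lam : ℂ) * w j 1
        = -∑ k : Fin n, (if m ≤ (k : ℕ) then (d.r k j : ℂ) * (d.a k 1 lam : ℂ) * w k 1 else 0))

/-- Assumption (H1): for `λ = 0`, `μ = i` the eigenvalue problem has exactly one
nontrivial solution up to linear dependence. -/
def HypH1 : Prop :=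
  ∃ v, d.IsEV 0 Complex.I v ∧ Nontriv v ∧
    ∀ v', d.IsEV 0 Complex.I v' → ∃ c : ℂ, ∀ (j : Fin n), ∀ x ∈ Set.Icc (0:ℝ) 1, v' j x = c * v j x

/-- Assumption (H2): algebraic simplicity. -/
def HypH2 : Prop :=
  ∀ v w, d.IsEV 0 Complex.I v → Nontriv v → d.IsAEV 0 (-Complex.I) w → Nontriv w →
    (∑ j : Fin n, ∫ x in (0:ℝ)..1, v j x * starRingEnd ℂ (w j x)) ≠ 0

/-- Assumption (H4): nonresonance. -/
def HypH4 : Prop :=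
  ∀ k : ℤ, (∃ v, d.IsEV 0 (Complex.I * k) v ∧ Nontriv v) → k = 1 ∨ k = -1

end HypData

/-- Normalization `Σ_j ∫_0^1 v⁰_j conj(w⁰_j) dx = 2`. -/
def NormalizedPair {n : ℕ} (v0 w0 : Fin n → ℝ → ℂ) : Prop :=
  (∑ j : Fin n, ∫ x in (0:ℝ)..1, v0 j x * starRingEnd ℂ (w0 j x)) = 2

/-- The transversality quantity `α`. -/
def alphaVal {n m : ℕ} (d : HypData n m) (v0 v0' w0 : Fin n → ℝ → ℂ) : ℝ :=
  (1/2) * (∑ j : Fin n, ∫ x in (0:ℝ)..1,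
    ((deriv (fun lam => d.a j x lam) 0 : ℂ) * v0' j x
      + ∑ k : Fin n, (deriv (fun lam => d.dbu j k x lam) 0 : ℂ) * v0 k x)
      * starRingEnd ℂ (w0 j x)).re

/-- The bifurcation-direction quantity `β`. -/
def betaVal {n m : ℕ} (d : HypData n m) (v0 w0 y z : Fin n → ℝ → ℂ) : ℝ :=
  -(∫ x in (0:ℝ)..1,
      ((1/8 : ℂ) * ∑ j : Fin n, ∑ k : Fin n, ∑ l : Fin n, ∑ rr : Fin n,
          (d.dbu3 j k l rr x 0 : ℂ) * v0 k x * v0 l x *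
            starRingEnd ℂ (v0 rr x) * starRingEnd ℂ (w0 j x)
        + ∑ j : Fin n, ∑ k : Fin n, ∑ l : Fin n,
          (d.dbu2 j k l x 0 : ℂ) * (y k x * starRingEnd ℂ (v0 l x) + z k x * v0 l x) *
            starRingEnd ℂ (w0 j x))).re

end
section AuxiliaryNorms

variable {n : ℕ}

theorem IsCnFun.continuous_apply {U : ℝ → ℝ → Fin n → ℝ} (hU : IsCnFun U) {x : ℝ}
    (hx : x ∈ Set.Icc (0:ℝ) 1) (k : Fin n) : Continuous fun t => U x t k := by
  have h : Continuous fun t : ℝ => U x t :=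
    hU.1.comp_continuous (f := fun t : ℝ => (x, t)) (by fun_prop) fun t => ⟨hx, trivial⟩
  exact (_root_.continuous_apply k).comp h

theorem IsCnFun.add_intCast_mul {U : ℝ → ℝ → Fin n → ℝ} (hU : IsCnFun U) (x t : ℝ) (z : ℤ) :
    U x (t + z * (2 * Real.pi)) = U x t :=
  (show Function.Periodic (U x) (2 * Real.pi) from hU.2 x).int_mul z t

/-- Every time is a translate, by an integer number of periods, of a time in one period. -/
theorem exists_period_shift (t : ℝ) :
    ∃ z : ℤ, t + z * (2 * Real.pi) ∈ Set.Icc 0 (2 * Real.pi) := by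
  refine ⟨-⌊t / (2 * Real.pi)⌋, ?_⟩
  have hpi : 0 < 2 * Real.pi := Real.two_pi_pos
  have h1 := Int.floor_le (t / (2 * Real.pi))
  have h2 := (Int.lt_floor_add_one (t / (2 * Real.pi))).le
  rw [le_div_iff₀ hpi] at h1
  rw [div_le_iff₀ hpi] at h2
  push_cast
  constructor <;> nlinarith

theorem IsCnFun.exists_bound {U : ℝ → ℝ → Fin n → ℝ} (hU : IsCnFun U) :
    ∃ B, ∀ x ∈ Set.Icc (0:ℝ) 1, ∀ t j, |U x t j| ≤ B := by
  obtain ⟨B, hB⟩ := (isCompact_Icc.prod isCompact_Icc).exists_bound_of_continuousOn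
    (hU.1.mono (Set.prod_mono le_rfl (Set.subset_univ (Set.Icc 0 (2 * Real.pi)))))
  refine ⟨B, fun x hx t j => ?_⟩
  obtain ⟨z, hz⟩ := exists_period_shift t
  rw [← hU.add_intCast_mul x t z]
  exact (norm_le_pi_norm (U x _) j).trans (hB (x, _) ⟨hx, hz⟩)

theorem IsCnFun.bddAbove {U : ℝ → ℝ → Fin n → ℝ} (hU : IsCnFun U) :
    BddAbove {y : ℝ | ∃ x ∈ Set.Icc (0:ℝ) 1, ∃ t : ℝ, ∃ j : Fin n, y = |U x t j|} := by
  obtain ⟨B, hB⟩ := hU.exists_bound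
  refine ⟨B, ?_⟩
  rintro y ⟨x, hx, t, j, rfl⟩
  exact hB x hx t j

theorem IsCnFun.abs_le_supNorm {U : ℝ → ℝ → Fin n → ℝ} (hU : IsCnFun U) {x : ℝ}
    (hx : x ∈ Set.Icc (0:ℝ) 1) (t : ℝ) (j : Fin n) : |U x t j| ≤ supNorm U :=
  le_csSup hU.bddAbove ⟨x, hx, t, j, rfl⟩

theorem supNorm_nonneg (U : ℝ → ℝ → Fin n → ℝ) : 0 ≤ supNorm U := by
  refine Real.sSup_nonneg ?_
  rintro y ⟨x, _, t, j, rfl⟩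
  exact abs_nonneg _

theorem supNorm_le {U : ℝ → ℝ → Fin n → ℝ} {B : ℝ} (hB : 0 ≤ B)
    (h : ∀ x ∈ Set.Icc (0:ℝ) 1, ∀ t j, |U x t j| ≤ B) : supNorm U ≤ B := by
  refine Real.sSup_le ?_ hB
  rintro y ⟨x, hx, t, j, rfl⟩
  exact h x hx t j

/-- Elements of `C_n` are uniformly continuous in time. -/
theorem IsCnFun.uniform_time {U : ℝ → ℝ → Fin n → ℝ} (hU : IsCnFun U) {ε : ℝ} (hε : 0 < ε) :
    ∃ δ > 0, ∀ x ∈ Set.Icc (0:ℝ) 1, ∀ s t j, |s - t| < δ → |U x s j - U x t j| < ε := by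
  have huc := (isCompact_Icc.prod isCompact_Icc).uniformContinuousOn_of_continuous
    (hU.1.mono (Set.prod_mono le_rfl (Set.subset_univ (Set.Icc (-1) (2 * Real.pi + 1)))))
  obtain ⟨δ, hδ, h⟩ := Metric.uniformContinuousOn_iff.1 huc ε hε
  refine ⟨min δ 1, lt_min hδ one_pos, fun x hx s t j hst => ?_⟩
  obtain ⟨z, hz⟩ := exists_period_shift t
  have hst' := abs_lt.1 (hst.trans_le (min_le_right _ _))
  have hs : s + z * (2 * Real.pi) ∈ Set.Icc (-1) (2 * Real.pi + 1) := by
    constructor <;> linarith [hz.1, hz.2, hst'.1, hst'.2]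
  have ht : t + z * (2 * Real.pi) ∈ Set.Icc (-1) (2 * Real.pi + 1) := by
    constructor <;> linarith [hz.1, hz.2]
  have hd := h (x, s + z * (2 * Real.pi)) ⟨hx, hs⟩ (x, t + z * (2 * Real.pi)) ⟨hx, ht⟩ (by
    rw [Prod.dist_eq, dist_self, Real.dist_eq, add_sub_add_right_eq_sub]
    exact max_lt hδ (hst.trans_le (min_le_left _ _)))
  dsimp only at hd
  rw [hU.add_intCast_mul, hU.add_intCast_mul] at hd
  exact (dist_le_pi_dist (U x s) (U x t) j).trans_lt hd

theorem IsCn1Fun.isCnFun_pdx {f : ℝ → ℝ → Fin n → ℝ} (hf : IsCn1Fun f) : IsCnFun (pdx f) := by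
  refine ⟨hf.2.2.1, fun x t => funext fun j => ?_⟩
  simp only [pdx, hf.1.2]

theorem IsCn1Fun.isCnFun_pdt {f : ℝ → ℝ → Fin n → ℝ} (hf : IsCn1Fun f) : IsCnFun (pdt f) := by
  refine ⟨hf.2.2.2, fun x t => funext fun j => ?_⟩
  simp only [pdt]
  rw [← deriv_comp_add_const]
  simp only [hf.1.2]

/-- The time difference quotients of a `C¹` function converge uniformly. -/
theorem IsCn1Fun.uniform_slope {f : ℝ → ℝ → Fin n → ℝ} (hf : IsCn1Fun f) {ε : ℝ} (hε : 0 < ε) :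
    ∃ δ > 0, ∀ x ∈ Set.Icc (0:ℝ) 1, ∀ t j h, h ≠ 0 → |h| < δ →
      |(f x (t + h) j - f x t j) / h - pdt f x t j| ≤ ε := by
  obtain ⟨δ, hδ, hu⟩ := hf.isCnFun_pdt.uniform_time hε
  refine ⟨δ, hδ, fun x hx t j h h0 hh => ?_⟩
  have hder : ∀ s, HasDerivAt (fun s => f x s j - pdt f x t j * s)
      (pdt f x s j - pdt f x t j * 1) s := fun s =>
    ((hf.2.1 j s x hx).2.hasDerivAt).sub ((hasDerivAt_id s).const_mul _)
  have hmv := (convex_ball t δ).norm_image_sub_le_of_norm_hasDerivWithin_le (C := ε)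
    (fun s _ => (hder s).hasDerivWithinAt) (fun s hs => by
      rw [mul_one]; exact (hu x hx s t j (by simpa [Real.dist_eq] using hs)).le)
    (Metric.mem_ball_self hδ) (show t + h ∈ Metric.ball t δ by simpa [Real.dist_eq] using hh)
  have hp : 0 < |h| := abs_pos.2 h0
  have he : (f x (t + h) j - f x t j) / h - pdt f x t j
      = ((f x (t + h) j - pdt f x t j * (t + h)) - (f x t j - pdt f x t j * t)) / h := by
    field_simp; ring
  rw [he, abs_div, div_le_iff₀ hp]
  simpa [Real.norm_eq_abs] using hmv

end AuxiliaryNorms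

/-- The data of an operator that reads off boundary values, transports them along
characteristics and multiplies them by a weight. -/
structure ReflData (n : ℕ) where
  c : Fin n → ℝ → ℝ
  σ : Fin n → ℝ → ℝ
  e : Fin n → ℝ
  ρ : Fin n → Fin n → ℝ

namespace ReflData

variable {n : ℕ} (R : ReflData n)

/-- The reflection operator. -/
def op (U : ℝ → ℝ → Fin n → ℝ) (x t : ℝ) (j : Fin n) : ℝ :=
  R.c j x * ∑ k, R.ρ j k * U (R.e j) (R.σ j x + t) k

/-- The reflection operator is a `q`-contraction in the sup-norm with weights `w`. -/
structure Contr (w : Fin n → ℝ) (q : ℝ) : Prop where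
  w_pos : ∀ j, 0 < w j
  q_nonneg : 0 ≤ q
  q_lt : q < 1
  e_mem : ∀ j, R.e j ∈ Set.Icc (0:ℝ) 1
  row : ∀ j, ∀ x ∈ Set.Icc (0:ℝ) 1, |R.c j x| * ∑ k, |R.ρ j k| * w k ≤ q * w j
  cont_c : ∀ j, ContinuousOn (R.c j) (Set.Icc 0 1)
  cont_σ : ∀ j, ContinuousOn (R.σ j) (Set.Icc 0 1)

variable {R} {w : Fin n → ℝ} {q : ℝ}

theorem abs_sum_le (ρ v : Fin n → ℝ) {B : ℝ} (hv : ∀ k, |v k| ≤ B * w k) :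
    |∑ k, ρ k * v k| ≤ B * ∑ k, |ρ k| * w k := by
  refine (Finset.abs_sum_le_sum_abs _ _).trans ?_
  rw [Finset.mul_sum]
  refine Finset.sum_le_sum fun k _ => ?_
  rw [abs_mul, mul_left_comm]
  exact mul_le_mul_of_nonneg_left (hv k) (abs_nonneg _)

theorem Contr.weighted_sum_le (h : R.Contr w q) {v : Fin n → ℝ} {B : ℝ} (hB : 0 ≤ B)
    (hv : ∀ k, |v k| ≤ B * w k) {x : ℝ} (hx : x ∈ Set.Icc (0:ℝ) 1) (j : Fin n) :
    |R.c j x| * |∑ k, R.ρ j k * v k| ≤ q * B * w j := by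
  calc _ ≤ |R.c j x| * (B * ∑ k, |R.ρ j k| * w k) :=
        mul_le_mul_of_nonneg_left (abs_sum_le _ _ hv) (abs_nonneg _)
    _ = B * (|R.c j x| * ∑ k, |R.ρ j k| * w k) := by ring
    _ ≤ B * (q * w j) := mul_le_mul_of_nonneg_left (h.row j x hx) hB
    _ = _ := by ring

theorem Contr.abs_op_le (h : R.Contr w q) {U : ℝ → ℝ → Fin n → ℝ} {B : ℝ} (hB : 0 ≤ B)
    (hU : ∀ x ∈ Set.Icc (0:ℝ) 1, ∀ t j, |U x t j| ≤ B * w j) {x : ℝ}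
    (hx : x ∈ Set.Icc (0:ℝ) 1) (t : ℝ) (j : Fin n) : |R.op U x t j| ≤ q * B * w j := by
  rw [op, abs_mul]
  exact h.weighted_sum_le hB (fun k => hU _ (h.e_mem j) _ k) hx j

/-- A bounded `U` is controlled by `U - op U`. -/
theorem Contr.apriori (h : R.Contr w q) {U : ℝ → ℝ → Fin n → ℝ}
    (hb : ∃ B, ∀ x ∈ Set.Icc (0:ℝ) 1, ∀ t j, |U x t j| ≤ B) {F : ℝ} (hF : 0 ≤ F)
    (hU : ∀ x ∈ Set.Icc (0:ℝ) 1, ∀ t j, |U x t j - R.op U x t j| ≤ F * w j) :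
    ∀ x ∈ Set.Icc (0:ℝ) 1, ∀ t j, |U x t j| ≤ F / (1 - q) * w j := by
  set S : Set ℝ := {y | ∃ x ∈ Set.Icc (0:ℝ) 1, ∃ t : ℝ, ∃ j, y = |U x t j| / w j} with hS
  have hbdd : BddAbove S := by
    obtain ⟨B, hB⟩ := hb
    refine ⟨∑ k, |B| / w k, ?_⟩
    rintro y ⟨x, hx, t, j, rfl⟩
    calc |U x t j| / w j ≤ |B| / w j :=
          div_le_div_of_nonneg_right ((hB x hx t j).trans (le_abs_self B)) (h.w_pos j).le
      _ ≤ ∑ k, |B| / w k := Finset.single_le_sum (f := fun k => |B| / w k)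
          (fun k _ => div_nonneg (abs_nonneg _) (h.w_pos k).le) (Finset.mem_univ j)
  have hM0 : 0 ≤ sSup S := by
    refine Real.sSup_nonneg ?_
    rintro y ⟨x, hx, t, j, rfl⟩
    exact div_nonneg (abs_nonneg _) (h.w_pos j).le
  have hM : ∀ x ∈ Set.Icc (0:ℝ) 1, ∀ t j, |U x t j| ≤ sSup S * w j := fun x hx t j =>
    (div_le_iff₀ (h.w_pos j)).1 (le_csSup hbdd ⟨x, hx, t, j, rfl⟩)
  have hstep : sSup S ≤ q * sSup S + F := by
    refine Real.sSup_le ?_ (add_nonneg (mul_nonneg h.q_nonneg hM0) hF)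
    rintro y ⟨x, hx, t, j, rfl⟩
    rw [div_le_iff₀ (h.w_pos j)]
    have h1 := h.abs_op_le hM0 hM hx t j
    have h2 := abs_add_le (U x t j - R.op U x t j) (R.op U x t j)
    rw [sub_add_cancel] at h2
    linarith [hU x hx t j]
  have hq : 0 < 1 - q := sub_pos.2 h.q_lt
  have hle : sSup S ≤ F / (1 - q) := by
    rw [le_div_iff₀ hq]; linarith
  exact fun x hx t j => (hM x hx t j).trans (mul_le_mul_of_nonneg_right hle (h.w_pos j).le)

theorem continuousOn_transport {s : ℝ → ℝ} (hs : ContinuousOn s (Set.Icc 0 1))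
    {v : ℝ → ℝ} (hv : Continuous v) :
    ContinuousOn (fun p : ℝ × ℝ => v (s p.1 + p.2)) (Set.Icc 0 1 ×ˢ Set.univ) :=
  hv.comp_continuousOn
    ((hs.comp continuousOn_fst fun _ hp => hp.1).add continuousOn_snd)

theorem Contr.continuousOn_sum (h : R.Contr w q) {U : ℝ → ℝ → Fin n → ℝ} (hU : IsCnFun U)
    (j : Fin n) : ContinuousOn
      (fun p : ℝ × ℝ => ∑ k, R.ρ j k * U (R.e j) (R.σ j p.1 + p.2) k)
      (Set.Icc 0 1 ×ˢ Set.univ) :=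
  continuousOn_finsetSum _ fun k _ => continuousOn_const.mul
    (continuousOn_transport (h.cont_σ j) (hU.continuous_apply (h.e_mem j) k))

theorem Contr.isCnFun_op (h : R.Contr w q) {U : ℝ → ℝ → Fin n → ℝ} (hU : IsCnFun U) :
    IsCnFun (R.op U) := by
  refine ⟨continuousOn_pi.2 fun j => ?_, fun x t => funext fun j => ?_⟩
  · exact ((h.cont_c j).comp continuousOn_fst fun _ hp => hp.1).mul (h.continuousOn_sum hU j)
  · simp only [op, ← add_assoc, hU.2]

/-- Solvability of `U = op U + f` in `C_n` by the Neumann series. -/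
theorem Contr.exists_solution (h : R.Contr w q) {f : ℝ → ℝ → Fin n → ℝ} (hf : IsCnFun f) :
    ∃ U, IsCnFun U ∧ ∀ x ∈ Set.Icc (0:ℝ) 1, ∀ t j, U x t j = R.op U x t j + f x t j := by
  have hcn : ∀ i, IsCnFun (R.op^[i] f) := fun i => by
    induction i with
    | zero => exact hf
    | succ i ih => rw [Function.iterate_succ_apply']; exact h.isCnFun_op ih
  obtain ⟨B, hB⟩ := hf.exists_bound
  obtain ⟨F, hF0, hF⟩ : ∃ F, 0 ≤ F ∧ ∀ j, B ≤ F * w j := by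
    refine ⟨∑ k, |B| / w k, Finset.sum_nonneg fun k _ =>
      div_nonneg (abs_nonneg _) (h.w_pos k).le, fun j => ?_⟩
    rw [← div_le_iff₀ (h.w_pos j)]
    exact (div_le_div_of_nonneg_right (le_abs_self B) (h.w_pos j).le).trans
      (Finset.single_le_sum (f := fun k => |B| / w k)
        (fun k _ => div_nonneg (abs_nonneg _) (h.w_pos k).le) (Finset.mem_univ j))
  have hbd : ∀ i, ∀ x ∈ Set.Icc (0:ℝ) 1, ∀ t j, |(R.op^[i] f) x t j| ≤ q ^ i * F * w j := by
    intro i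
    induction i with
    | zero => intro x hx t j; simpa using (hB x hx t j).trans (hF j)
    | succ i ih =>
      intro x hx t j
      rw [Function.iterate_succ_apply', pow_succ', mul_assoc q]
      exact h.abs_op_le (mul_nonneg (pow_nonneg h.q_nonneg i) hF0) ih hx t j
  have hgeo : ∀ j, Summable fun i : ℕ => q ^ i * F * w j := fun j =>
    ((summable_geometric_of_lt_one h.q_nonneg h.q_lt).mul_right F).mul_right (w j)
  have hsum : ∀ x ∈ Set.Icc (0:ℝ) 1, ∀ t j, Summable fun i => (R.op^[i] f) x t j :=
    fun x hx t j => Summable.of_norm_bounded (hgeo j) fun i => hbd i x hx t j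
  refine ⟨fun x t j => ∑' i, (R.op^[i] f) x t j, ⟨continuousOn_pi.2 fun j => ?_,
    fun x t => funext fun j => ?_⟩, fun x hx t j => ?_⟩
  · exact continuousOn_tsum (fun i => continuousOn_pi.1 (hcn i).1 j) (hgeo j)
      fun i p hp => hbd i p.1 hp.1 p.2 j
  · exact tsum_congr fun i => congrFun ((hcn i).2 x t) j
  · dsimp only
    rw [(hsum x hx t j).tsum_eq_zero_add, add_comm]
    congr 1
    simp only [Function.iterate_succ_apply', op]
    rw [tsum_mul_left, Summable.tsum_finsetSum fun k _ => (hsum _ (h.e_mem j) _ k).mul_left _]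
    simp only [tsum_mul_left]

theorem op_sub (U V : ℝ → ℝ → Fin n → ℝ) (x t : ℝ) (j : Fin n) :
    R.op (fun x t j => U x t j - V x t j) x t j = R.op U x t j - R.op V x t j := by
  simp only [op, mul_sub, Finset.sum_sub_distrib]

theorem op_div (U : ℝ → ℝ → Fin n → ℝ) (a x t : ℝ) (j : Fin n) :
    R.op (fun x t j => U x t j / a) x t j = R.op U x t j / a := by
  simp only [op, ← mul_div_assoc, ← Finset.sum_div]

theorem op_shift (U : ℝ → ℝ → Fin n → ℝ) (a x t : ℝ) (j : Fin n) :
    R.op (fun x t j => U x (t + a) j) x t j = R.op U x (t + a) j := by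
  simp only [op, add_assoc]

/-- The time derivative of a solution solves the equation with differentiated right-hand side. -/
theorem Contr.hasDerivAt_time (h : R.Contr w q) {f U W : ℝ → ℝ → Fin n → ℝ} (hf : IsCn1Fun f)
    (hU : IsCnFun U) (hUe : ∀ x ∈ Set.Icc (0:ℝ) 1, ∀ t j, U x t j = R.op U x t j + f x t j)
    (hW : IsCnFun W) (hWe : ∀ x ∈ Set.Icc (0:ℝ) 1, ∀ t j, W x t j = R.op W x t j + pdt f x t j)
    {x : ℝ} (hx : x ∈ Set.Icc (0:ℝ) 1) (t : ℝ) (j : Fin n) :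
    HasDerivAt (fun s => U x s j) (W x t j) t := by
  obtain ⟨v, hv0, hv⟩ : ∃ v > 0, ∀ k, v ≤ w k := by
    obtain ⟨k, -, hk⟩ := Finset.exists_min_image Finset.univ w ⟨j, Finset.mem_univ j⟩
    exact ⟨w k, h.w_pos k, fun i => hk i (Finset.mem_univ i)⟩
  have hq : 0 < 1 - q := sub_pos.2 h.q_lt
  rw [hasDerivAt_iff_tendsto_slope_zero, Metric.tendsto_nhdsWithin_nhds]
  intro ε hε
  set η := ε * (1 - q) / (2 * w j) with hη
  have hη0 : 0 < η := by have := h.w_pos j; positivity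
  obtain ⟨δ, hδ, hs⟩ := hf.uniform_slope (mul_pos hη0 hv0)
  refine ⟨δ, hδ, fun {a} ha had => ?_⟩
  have ha0 : a ≠ 0 := ha
  have had' : |a| < δ := by simpa [Real.dist_eq] using had
  set E : ℝ → ℝ → Fin n → ℝ := fun x t j => (U x (t + a) j - U x t j) / a - W x t j with hE
  obtain ⟨BU, hBU⟩ := hU.exists_bound
  obtain ⟨BW, hBW⟩ := hW.exists_bound
  have hEb : ∃ B, ∀ x ∈ Set.Icc (0:ℝ) 1, ∀ t j, |E x t j| ≤ B := by
    refine ⟨(BU + BU) / |a| + BW, fun x hx t j => ?_⟩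
    refine (abs_sub _ _).trans (add_le_add ?_ (hBW x hx t j))
    rw [abs_div]
    exact div_le_div_of_nonneg_right
      ((abs_sub _ _).trans (add_le_add (hBU x hx _ j) (hBU x hx t j))) (abs_nonneg a)
  have hEe : ∀ x ∈ Set.Icc (0:ℝ) 1, ∀ t j, |E x t j - R.op E x t j| ≤ η * w j := by
    intro x hx t j
    have hop : R.op E x t j = (R.op U x (t + a) j - R.op U x t j) / a - R.op W x t j := by
      rw [hE, op_sub (fun x t j => (U x (t + a) j - U x t j) / a) W,
        op_div (fun x t j => U x (t + a) j - U x t j), op_sub (fun x t j => U x (t + a) j) U,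
        op_shift]
    have : E x t j - R.op E x t j = (f x (t + a) j - f x t j) / a - pdt f x t j := by
      rw [hop, hE]
      dsimp only
      rw [hUe x hx (t + a) j, hUe x hx t j, hWe x hx t j]
      ring
    rw [this]
    exact (hs x hx t j a ha0 had').trans (mul_le_mul_of_nonneg_left (hv j) hη0.le)
  have key := h.apriori hEb hη0.le hEe x hx t j
  have hval : η / (1 - q) * w j = ε / 2 := by
    have := (h.w_pos j).ne'
    rw [hη]; field_simp
  rw [hval] at key
  rw [Real.dist_eq, smul_eq_mul, inv_mul_eq_div]
  exact key.trans_lt (half_lt_self hε)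

/-- The sup-norm bound for solutions. -/
theorem Contr.abs_solution_le (h : R.Contr w q) {v : ℝ} (hv0 : 0 < v)
    (hv : ∀ j, v ≤ w j) {f U : ℝ → ℝ → Fin n → ℝ} (hf : IsCnFun f)
    (hU : IsCnFun U) (hUe : ∀ x ∈ Set.Icc (0:ℝ) 1, ∀ t j, U x t j = R.op U x t j + f x t j) :
    ∀ x ∈ Set.Icc (0:ℝ) 1, ∀ t j, |U x t j| ≤ supNorm f / (v * (1 - q)) * w j := by
  have key := h.apriori hU.exists_bound (F := supNorm f / v)
    (div_nonneg (supNorm_nonneg f) hv0.le) fun x hx t j => by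
      rw [hUe x hx t j, add_sub_cancel_left, div_mul_eq_mul_div, le_div_iff₀ hv0]
      exact mul_le_mul (hf.abs_le_supNorm hx t j) (hv j) hv0.le (supNorm_nonneg f)
  simpa only [div_div] using key

/-- Regularity and bounds for solutions with `C¹` right-hand sides. -/
theorem Contr.isCn1Fun_solution (h : R.Contr w q) {c' σ' : Fin n → ℝ → ℝ}
    (hc : ∀ j, ∀ x ∈ Set.Icc (0:ℝ) 1, HasDerivWithinAt (R.c j) (c' j x) (Set.Icc 0 1) x)
    (hσ : ∀ j, ∀ x ∈ Set.Icc (0:ℝ) 1, HasDerivWithinAt (R.σ j) (σ' j x) (Set.Icc 0 1) x)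
    (hc' : ∀ j, ContinuousOn (c' j) (Set.Icc 0 1))
    (hσ' : ∀ j, ContinuousOn (σ' j) (Set.Icc 0 1)) {G S : ℝ} (hG0 : 0 ≤ G) (hS0 : 0 ≤ S)
    (hG : ∀ j, ∀ x ∈ Set.Icc (0:ℝ) 1, |c' j x| ≤ G * |R.c j x|)
    (hS : ∀ j, ∀ x ∈ Set.Icc (0:ℝ) 1, |σ' j x| ≤ S) {v V : ℝ} (hv0 : 0 < v)
    (hv : ∀ j, v ≤ w j) (hV0 : 0 ≤ V) (hV : ∀ j, w j ≤ V)
    {f U : ℝ → ℝ → Fin n → ℝ} (hf : IsCn1Fun f)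
    (hU : IsCnFun U) (hUe : ∀ x ∈ Set.Icc (0:ℝ) 1, ∀ t j, U x t j = R.op U x t j + f x t j) :
    IsCn1Fun U ∧ c1Norm U ≤ (1 + (1 + G + S) * (V / (v * (1 - q)))) * c1Norm f := by
  obtain ⟨W, hW, hWe⟩ := h.exists_solution hf.isCnFun_pdt
  have hq : 0 < 1 - q := sub_pos.2 h.q_lt
  have hvq : 0 < v * (1 - q) := mul_pos hv0 hq
  have hdt : ∀ x ∈ Set.Icc (0:ℝ) 1, ∀ t j, HasDerivAt (fun s => U x s j) (W x t j) t :=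
    fun x hx t j => h.hasDerivAt_time hf hU hUe hW hWe hx t j
  have hpt : ∀ x ∈ Set.Icc (0:ℝ) 1, ∀ t j, pdt U x t j = W x t j :=
    fun x hx t j => (hdt x hx t j).deriv
  set D : ℝ → ℝ → Fin n → ℝ := fun x t j =>
    c' j x * (∑ k, R.ρ j k * U (R.e j) (R.σ j x + t) k) +
      R.c j x * (∑ k, R.ρ j k * (W (R.e j) (R.σ j x + t) k * σ' j x)) + pdx f x t j with hD
  have hdx : ∀ x ∈ Set.Icc (0:ℝ) 1, ∀ t j,
      HasDerivWithinAt (fun y => U y t j) (D x t j) (Set.Icc 0 1) x := by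
    intro x hx t j
    have hin : ∀ k, HasDerivWithinAt (fun y => U (R.e j) (R.σ j y + t) k)
        (W (R.e j) (R.σ j x + t) k * σ' j x) (Set.Icc 0 1) x := fun k =>
      HasDerivAt.comp_hasDerivWithinAt (h₂ := fun s => U (R.e j) s k) (h := fun y => R.σ j y + t) x
        (hdt _ (h.e_mem j) (R.σ j x + t) k) ((hσ j x hx).add_const t)
    have hs : HasDerivWithinAt (fun y => ∑ k, R.ρ j k * U (R.e j) (R.σ j y + t) k)
        (∑ k, R.ρ j k * (W (R.e j) (R.σ j x + t) k * σ' j x)) (Set.Icc 0 1) x :=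
      HasDerivWithinAt.fun_sum fun k _ => (hin k).const_mul _
    exact (((hc j x hx).mul hs).add (hf.2.1 j t x hx).1.hasDerivWithinAt).congr
      (fun y hy => hUe y hy t j) (hUe x hx t j)
  have hpx : ∀ x ∈ Set.Icc (0:ℝ) 1, ∀ t j, pdx U x t j = D x t j :=
    fun x hx t j => (hdx x hx t j).derivWithin (uniqueDiffOn_Icc zero_lt_one x hx)
  have hDeq : ∀ x t j, D x t j = c' j x * (∑ k, R.ρ j k * U (R.e j) (R.σ j x + t) k) +
      R.c j x * σ' j x * (∑ k, R.ρ j k * W (R.e j) (R.σ j x + t) k) + pdx f x t j := by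
    intro x t j
    simp only [hD, Finset.mul_sum]
    congr 2
    exact Finset.sum_congr rfl fun k _ => by ring
  have hfst : ∀ {g : ℝ → ℝ}, ContinuousOn g (Set.Icc 0 1) →
      ContinuousOn (fun p : ℝ × ℝ => g p.1) (Set.Icc 0 1 ×ˢ Set.univ) := fun hg =>
    hg.comp continuousOn_fst fun _ hp => hp.1
  have hDc : ContinuousOn (fun p : ℝ × ℝ => D p.1 p.2) (Set.Icc 0 1 ×ˢ Set.univ) := by
    refine continuousOn_pi.2 fun j => ?_
    simp only [hDeq]
    exact (((hfst (hc' j)).mul (h.continuousOn_sum hU j)).add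
      (((hfst (h.cont_c j)).mul (hfst (hσ' j))).mul (h.continuousOn_sum hW j))).add
      (continuousOn_pi.1 hf.2.2.1 j)
  refine ⟨⟨hU, fun j t x hx =>
      ⟨(hdx x hx t j).differentiableWithinAt, (hdt x hx t j).differentiableAt⟩,
      hDc.congr fun p hp => funext fun j => hpx p.1 hp.1 p.2 j,
      hW.1.congr fun p hp => funext fun j => hpt p.1 hp.1 p.2 j⟩, ?_⟩
  have hUb := h.abs_solution_le hv0 hv hf.1 hU hUe
  have hWb := h.abs_solution_le hv0 hv hf.isCnFun_pdt hW hWe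
  set a := supNorm f with ha
  set b := supNorm (pdx f) with hb
  set e := supNorm (pdt f) with he
  have ha0 : 0 ≤ a := supNorm_nonneg _
  have hb0 : 0 ≤ b := supNorm_nonneg _
  have he0 : 0 ≤ e := supNorm_nonneg _
  set L := V / (v * (1 - q)) with hL
  have hL0 : 0 ≤ L := by positivity
  have hscale : ∀ y, 0 ≤ y → ∀ j, y / (v * (1 - q)) * w j ≤ y * L := fun y hy j => by
    rw [hL, ← mul_div_assoc, div_mul_eq_mul_div]
    gcongr
    exact hV j
  have h1 : supNorm U ≤ a * L := supNorm_le (by positivity) fun x hx t j =>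
    (hUb x hx t j).trans (hscale a ha0 j)
  have h2 : supNorm (pdt U) ≤ e * L := supNorm_le (by positivity) fun x hx t j => by
    rw [hpt x hx t j]
    exact (hWb x hx t j).trans (hscale e he0 j)
  have hsumle : ∀ (Z : ℝ → ℝ → Fin n → ℝ) y, 0 ≤ y →
      (∀ x ∈ Set.Icc (0:ℝ) 1, ∀ t j, |Z x t j| ≤ y / (v * (1 - q)) * w j) →
      ∀ x ∈ Set.Icc (0:ℝ) 1, ∀ t j,
        |R.c j x| * |∑ k, R.ρ j k * Z (R.e j) (R.σ j x + t) k| ≤ y * L := by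
    intro Z y hy hZ x hx t j
    have hy' : 0 ≤ y / (v * (1 - q)) := by positivity
    refine (h.weighted_sum_le hy' (fun k => hZ _ (h.e_mem j) _ k) hx j).trans
      (le_trans ?_ (hscale y hy j))
    rw [mul_assoc]
    exact mul_le_of_le_one_left (mul_nonneg hy' (h.w_pos j).le) h.q_lt.le
  have h3 : supNorm (pdx U) ≤ G * (a * L) + S * (e * L) + b :=
    supNorm_le (by positivity) fun x hx t j => by
      rw [hpx x hx t j, hDeq]
      refine (abs_add_le _ _).trans (add_le_add ((abs_add_le _ _).trans (add_le_add ?_ ?_))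
        (hf.isCnFun_pdx.abs_le_supNorm hx t j))
      · rw [abs_mul]
        refine (mul_le_mul_of_nonneg_right (hG j x hx) (abs_nonneg _)).trans ?_
        rw [mul_assoc]
        exact mul_le_mul_of_nonneg_left (hsumle U a ha0 hUb x hx t j) hG0
      · rw [abs_mul, abs_mul, mul_comm |R.c j x|, mul_assoc]
        exact mul_le_mul (hS j x hx) (hsumle W e he0 hWb x hx t j) (by positivity) hS0
  have hfin : c1Norm U ≤ a * L + (G * (a * L) + S * (e * L) + b) + e * L :=
    add_le_add (add_le_add h1 h3) h2
  have hcf : c1Norm f = a + b + e := rfl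
  rw [hcf]
  refine hfin.trans ?_
  have p1 : 0 ≤ G * L * e := by positivity
  have p2 : 0 ≤ G * L * b := by positivity
  have p3 : 0 ≤ S * L * a := by positivity
  have p4 : 0 ≤ S * L * b := by positivity
  have p5 : 0 ≤ L * b := by positivity
  nlinarith

end ReflData

namespace HypData

variable {n m : ℕ} (d : HypData n m)

/-- The data of the reflection operator `C(λ,ω)`. -/
noncomputable def reflData (lam ω : ℝ) : ReflData n where
  c j x := d.cfac j (xjv m j) x lam
  σ j x := ω * ∫ η in x..(xjv m j), (d.a j η lam)⁻¹
  e := xjv m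
  ρ j k := if (j : ℕ) < m then (if m ≤ (k : ℕ) then d.r j k else 0)
    else (if (k : ℕ) < m then d.r j k else 0)

theorem CopRaw_eq_op (lam ω : ℝ) (U : ℝ → ℝ → Fin n → ℝ) (x t : ℝ) (j : Fin n) :
    d.CopRaw lam ω U x t j = (d.reflData lam ω).op U x t j := by
  by_cases hj : (j : ℕ) < m <;> simp [CopRaw, ReflData.op, reflData, xjv, tau, hj]

theorem xjv_mem (j : Fin n) : xjv m j ∈ Set.Icc (0:ℝ) 1 := by
  unfold xjv; split_ifs <;> simp

variable {d}

theorem StandingHyps.continuous_dbu {δ0 : ℝ} (hyp : d.StandingHyps δ0) (j k : Fin n) :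
    Continuous fun p : ℝ × ℝ => d.dbu j k p.1 p.2 := by
  have hb : ContDiff ℝ 1 (Function.uncurry fun (p : ℝ × ℝ) (u : Fin n → ℝ) => d.b j p.1 p.2 u) :=
    ((hyp.2.2.2.1 j).of_le (by exact_mod_cast le_top)).comp
      (f := fun p : (ℝ × ℝ) × (Fin n → ℝ) => (p.1.1, p.1.2, p.2)) (by fun_prop)
  have := (hb.fderiv (g := fun _ => 0) (n := 0) contDiff_const (by norm_num)).continuous
  exact this.clm_apply continuous_const

theorem StandingHyps.continuous_a {δ0 : ℝ} (hyp : d.StandingHyps δ0) (j : Fin n) :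
    Continuous fun p : ℝ × ℝ => d.a j p.1 p.2 := (hyp.2.2.1 j).continuous

theorem StandingHyps.delta_pos {δ0 : ℝ} (hyp : d.StandingHyps δ0) : 0 < δ0 :=
  hyp.2.2.2.2.2.2.2.1

theorem StandingHyps.a_ne {δ0 : ℝ} (hyp : d.StandingHyps δ0) (j : Fin n) {x lam : ℝ}
    (hx : x ∈ Set.Icc (0:ℝ) 1) (hl : lam ∈ Set.Icc (-δ0) δ0) : d.a j x lam ≠ 0 :=
  hyp.2.2.2.2.2.2.2.2 j x hx lam hl

theorem StandingHyps.continuousOn_inv_a {δ0 : ℝ} (hyp : d.StandingHyps δ0) :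
    ContinuousOn (fun (p : ℝ × ℝ) (j : Fin n) => (d.a j p.1 p.2)⁻¹)
      (Set.Icc 0 1 ×ˢ Set.Icc (-δ0) δ0) :=
  continuousOn_pi.2 fun j => (hyp.continuous_a j).continuousOn.inv₀ fun _ hp =>
    hyp.a_ne j hp.1 hp.2

theorem StandingHyps.continuousOn_ratio {δ0 : ℝ} (hyp : d.StandingHyps δ0) :
    ContinuousOn (fun (p : ℝ × ℝ) (j : Fin n) => d.dbu j j p.1 p.2 / d.a j p.1 p.2)
      (Set.Icc 0 1 ×ˢ Set.Icc (-δ0) δ0) :=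
  continuousOn_pi.2 fun j => (hyp.continuous_dbu j j).continuousOn.div
    (hyp.continuous_a j).continuousOn fun _ hp => hyp.a_ne j hp.1 hp.2

end HypData

theorem continuousOn_slice {n : ℕ} {g : ℝ × ℝ → Fin n → ℝ} {s t : Set ℝ}
    (hg : ContinuousOn g (s ×ˢ t)) (j : Fin n) {y : ℝ} (hy : y ∈ t) :
    ContinuousOn (fun x => g (x, y) j) s :=
  (continuousOn_pi.1 hg j).comp (by fun_prop) fun _ hx => ⟨hx, hy⟩

/-- Differentiation of an integral over `[x, e]` with respect to its lower limit. -/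
theorem hasDerivWithinAt_integral_lower {g : ℝ → ℝ} (hg : ContinuousOn g (Set.Icc 0 1)) {e x : ℝ}
    (he : e ∈ Set.Icc (0:ℝ) 1) (hx : x ∈ Set.Icc (0:ℝ) 1) :
    HasDerivWithinAt (fun y => ∫ η in y..e, g η) (-g x) (Set.Icc 0 1) x := by
  have : Fact (x ∈ Set.Icc (0:ℝ) 1) := ⟨hx⟩
  exact intervalIntegral.integral_hasDerivWithinAt_left
    (hg.mono (Set.uIcc_subset_Icc hx he)).intervalIntegrable
    (hg.stronglyMeasurableAtFilter_nhdsWithin measurableSet_Icc x) (hg x hx)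

theorem abs_integral_le_of_mem_Icc {g : ℝ → ℝ} {C x y : ℝ} (hC : 0 ≤ C)
    (hg : ∀ η ∈ Set.Icc (0:ℝ) 1, |g η| ≤ C) (hx : x ∈ Set.Icc (0:ℝ) 1)
    (hy : y ∈ Set.Icc (0:ℝ) 1) : |∫ η in x..y, g η| ≤ C := by
  have h := intervalIntegral.norm_integral_le_of_norm_le_const (f := g) (a := x) (b := y) (C := C)
    fun η hη => hg η (Set.uIcc_subset_Icc hx hy (Set.uIoc_subset_uIcc hη))
  have h1 : |y - x| ≤ 1 := by
    rw [abs_le]; constructor <;> linarith [hx.1, hx.2, hy.1, hy.2]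
  exact h.trans (mul_le_of_le_one_right hC h1)

/-- A slight increase of both factors keeps a product below one. -/
theorem exists_exp_mul_lt_one {a b : ℝ} (hab : a * b < 1) :
    ∃ ε > 0, (Real.exp ε * (a + ε)) * (Real.exp ε * (b + ε)) < 1 := by
  have hc : Continuous fun ε : ℝ => (Real.exp ε * (a + ε)) * (Real.exp ε * (b + ε)) := by fun_prop
  have hev : ∀ᶠ ε in 𝓝 (0:ℝ), (Real.exp ε * (a + ε)) * (Real.exp ε * (b + ε)) < 1 :=
    hc.continuousAt.eventually_lt_const (by simpa using hab)
  obtain ⟨ε, h, hε⟩ := ((hev.filter_mono nhdsWithin_le_nhds).and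
    (self_mem_nhdsWithin : Set.Ioi (0:ℝ) ∈ 𝓝[>] 0)).exists
  exact ⟨ε, hε, h⟩

namespace HypData

variable {n m : ℕ} {d : HypData n m}

/-- The row sums of `C(0,ω)` are bounded by `R₀` and `R₁`. -/
theorem StandingHyps.row_le {δ0 : ℝ} (hyp : d.StandingHyps δ0) (ω : ℝ) (j : Fin n) {x : ℝ}
    (hx : x ∈ Set.Icc (0:ℝ) 1) :
    d.cfac j (xjv m j) x 0 * ∑ k, |(d.reflData 0 ω).ρ j k| ≤
      if (j : ℕ) < m then d.R0c else d.R1c := by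
  have hzero : (0:ℝ) ∈ Set.Icc (-δ0) δ0 := ⟨by linarith [hyp.delta_pos], hyp.delta_pos.le⟩
  obtain ⟨G, hG⟩ := (isCompact_Icc.prod isCompact_Icc).exists_bound_of_continuousOn
    hyp.continuousOn_ratio
  have hG0 : 0 ≤ G := (norm_nonneg _).trans (hG (x, 0) ⟨hx, hzero⟩)
  have hbd : ∀ i, ∀ y ∈ Set.Icc (0:ℝ) 1,
      d.cfac i (xjv m i) y 0 * ∑ k, |(d.reflData 0 ω).ρ i k| ≤
        Real.exp G * ∑ l, ∑ k, |(d.reflData 0 ω).ρ l k| := fun i y hy => by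
    refine mul_le_mul (Real.exp_le_exp.2 ((le_abs_self _).trans
      (abs_integral_le_of_mem_Icc hG0 (fun η hη => ?_) hy (xjv_mem i)))) ?_
      (Finset.sum_nonneg fun k _ => abs_nonneg _) (Real.exp_pos _).le
    · exact (norm_le_pi_norm (fun l => d.dbu l l η 0 / d.a l η 0) i).trans
        (hG (η, 0) ⟨hη, hzero⟩)
    · exact Finset.single_le_sum (f := fun l => ∑ k, |(d.reflData 0 ω).ρ l k|)
        (fun l _ => Finset.sum_nonneg fun k _ => abs_nonneg _) (Finset.mem_univ i)
  have h0 : ∀ i : Fin n, (i : ℕ) < m → ∀ y, (∑ k : Fin n, (if m ≤ (k : ℕ) then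
      |d.r i k| * Real.exp (-∫ η in (0:ℝ)..y, d.dbu i i η 0 / d.a i η 0) else 0)) =
      d.cfac i (xjv m i) y 0 * ∑ k, |(d.reflData 0 ω).ρ i k| := by
    intro i hi y
    rw [Finset.mul_sum]
    refine Finset.sum_congr rfl fun k _ => ?_
    by_cases hk : m ≤ (k : ℕ)
    · simp [reflData, xjv, cfac, hi, hk, intervalIntegral.integral_symm y 0, mul_comm]
    · simp [reflData, hi, hk]
  have h1 : ∀ i : Fin n, m ≤ (i : ℕ) → ∀ y, (∑ k : Fin n, (if (k : ℕ) < m then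
      |d.r i k| * Real.exp (∫ η in y..(1:ℝ), d.dbu i i η 0 / d.a i η 0) else 0)) =
      d.cfac i (xjv m i) y 0 * ∑ k, |(d.reflData 0 ω).ρ i k| := by
    intro i hi y
    rw [Finset.mul_sum]
    refine Finset.sum_congr rfl fun k _ => ?_
    by_cases hk : (k : ℕ) < m
    · simp [reflData, xjv, cfac, hi.not_gt, hk, mul_comm]
    · simp [reflData, hi.not_gt, hk]
  set B := Real.exp G * ∑ l, ∑ k, |(d.reflData 0 ω).ρ l k|
  split_ifs with hj
  · refine le_csSup ⟨B, ?_⟩ ⟨j, hj, x, hx, (h0 j hj x).symm⟩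
    rintro _ ⟨i, hi, y, hy, rfl⟩
    rw [h0 i hi y]
    exact hbd i y hy
  · refine le_csSup ⟨B, ?_⟩ ⟨j, not_lt.1 hj, x, hx, (h1 j (not_lt.1 hj) x).symm⟩
    rintro _ ⟨i, hi, y, hy, rfl⟩
    rw [h1 i hi y]
    exact hbd i y hy

theorem R0c_nonneg (d : HypData n m) : 0 ≤ d.R0c := by
  refine Real.sSup_nonneg ?_
  rintro _ ⟨i, hi, y, hy, rfl⟩
  exact Finset.sum_nonneg fun k _ => by split_ifs <;> positivity

theorem R1c_nonneg (d : HypData n m) : 0 ≤ d.R1c := by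
  refine Real.sSup_nonneg ?_
  rintro _ ⟨i, hi, y, hy, rfl⟩
  exact Finset.sum_nonneg fun k _ => by split_ifs <;> positivity

theorem StandingHyps.hasDerivWithinAt_c {δ0 lam : ℝ} (hyp : d.StandingHyps δ0)
    (hl : lam ∈ Set.Icc (-δ0) δ0) (ω : ℝ) (j : Fin n) {x : ℝ} (hx : x ∈ Set.Icc (0:ℝ) 1) :
    HasDerivWithinAt ((d.reflData lam ω).c j)
      ((d.reflData lam ω).c j x * -(d.dbu j j x lam / d.a j x lam)) (Set.Icc 0 1) x :=
  (hasDerivWithinAt_integral_lower (continuousOn_slice hyp.continuousOn_ratio j hl)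
    (xjv_mem j) hx).exp

theorem StandingHyps.hasDerivWithinAt_σ {δ0 lam : ℝ} (hyp : d.StandingHyps δ0)
    (hl : lam ∈ Set.Icc (-δ0) δ0) (ω : ℝ) (j : Fin n) {x : ℝ} (hx : x ∈ Set.Icc (0:ℝ) 1) :
    HasDerivWithinAt ((d.reflData lam ω).σ j) (ω * -(d.a j x lam)⁻¹) (Set.Icc 0 1) x :=
  (hasDerivWithinAt_integral_lower (continuousOn_slice hyp.continuousOn_inv_a j hl)
    (xjv_mem j) hx).const_mul ω

/-- For small `λ` the weights `c_j` are close to those at `λ = 0`, up to a factor. -/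
theorem StandingHyps.exists_cfac_le {δ0 : ℝ} (hyp : d.StandingHyps δ0) {ε : ℝ} (hε : 0 < ε) :
    ∃ δ1, 0 < δ1 ∧ δ1 ≤ δ0 ∧ ∀ lam ∈ Set.Icc (-δ1) δ1, ∀ j, ∀ x ∈ Set.Icc (0:ℝ) 1,
      d.cfac j (xjv m j) x lam ≤ Real.exp ε * d.cfac j (xjv m j) x 0 := by
  have hzero : (0:ℝ) ∈ Set.Icc (-δ0) δ0 := ⟨by linarith [hyp.delta_pos], hyp.delta_pos.le⟩
  obtain ⟨δ, hδ, hu⟩ := Metric.uniformContinuousOn_iff.1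
    ((isCompact_Icc.prod isCompact_Icc).uniformContinuousOn_of_continuous
      hyp.continuousOn_ratio) ε hε
  refine ⟨min (δ / 2) δ0, lt_min (half_pos hδ) hyp.delta_pos, min_le_right _ _,
    fun lam hlam j x hx => ?_⟩
  have hl : lam ∈ Set.Icc (-δ0) δ0 := by
    constructor <;> linarith [hlam.1, hlam.2, min_le_right (δ / 2) δ0]
  have hld : |lam| < δ :=
    ((abs_le.2 hlam).trans (min_le_left _ _)).trans_lt (half_lt_self hδ)
  have hint : ∀ {l}, l ∈ Set.Icc (-δ0) δ0 → IntervalIntegrable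
      (fun η => d.dbu j j η l / d.a j η l) volume x (xjv m j) := fun hl =>
    ((continuousOn_slice hyp.continuousOn_ratio j hl).mono
      (Set.uIcc_subset_Icc hx (xjv_mem j))).intervalIntegrable
  rw [cfac, cfac, ← Real.exp_add, Real.exp_le_exp, ← sub_le_iff_le_add,
    ← intervalIntegral.integral_sub (hint hl) (hint hzero)]
  refine (le_abs_self _).trans (abs_integral_le_of_mem_Icc hε.le (fun η hη => ?_) hx (xjv_mem j))
  have hd := hu (η, lam) ⟨hη, hl⟩ (η, 0) ⟨hη, hzero⟩ (by
    rw [Prod.dist_eq, dist_self, Real.dist_eq, sub_zero]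
    exact max_lt hδ hld)
  exact ((dist_le_pi_dist _ _ j).trans_lt hd).le

/-- For small `λ` the operators `C(λ,ω)` are uniform contractions in a common weighted norm. -/
theorem StandingHyps.exists_contr {δ0 : ℝ} (hyp : d.StandingHyps δ0)
    (hdiss : d.R0c * d.R1c < 1) :
    ∃ δ1, 0 < δ1 ∧ δ1 ≤ δ0 ∧ ∃ w q, ∀ lam ∈ Set.Icc (-δ1) δ1, ∀ ω,
      (d.reflData lam ω).Contr w q := by
  obtain ⟨ε, hε, hlt⟩ := exists_exp_mul_lt_one hdiss
  obtain ⟨δ1, hδ1, hδ10, hcf⟩ := hyp.exists_cfac_le hε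
  set K0 := Real.exp ε * (d.R0c + ε) with hK0
  set K1 := Real.exp ε * (d.R1c + ε) with hK1
  have hK0p : 0 < K0 := mul_pos (Real.exp_pos _) (by linarith [d.R0c_nonneg])
  have hK1p : 0 < K1 := mul_pos (Real.exp_pos _) (by linarith [d.R1c_nonneg])
  refine ⟨δ1, hδ1, hδ10, fun j => if (j : ℕ) < m then √K0 else √K1, √K0 * √K1,
    fun lam hlam ω => ?_⟩
  have hl : lam ∈ Set.Icc (-δ0) δ0 := ⟨by linarith [hlam.1], by linarith [hlam.2]⟩
  refine ⟨fun j => ?_, by positivity, ?_, xjv_mem, fun j x hx => ?_,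
    fun j x hx => (hyp.hasDerivWithinAt_c hl ω j hx).continuousWithinAt,
    fun j x hx => (hyp.hasDerivWithinAt_σ hl ω j hx).continuousWithinAt⟩
  · split_ifs <;> positivity
  · rw [← Real.sqrt_mul hK0p.le]
    exact (Real.sqrt_lt_sqrt (by positivity) hlt).trans_eq Real.sqrt_one
  · have hpos : 0 < (d.reflData lam ω).c j x := Real.exp_pos _
    have hrow : (d.reflData lam ω).c j x * ∑ k, |(d.reflData lam ω).ρ j k| ≤
        if (j : ℕ) < m then K0 else K1 := by
      have hr := hyp.row_le ω j hx
      calc _ ≤ (Real.exp ε * d.cfac j (xjv m j) x 0) * ∑ k, |(d.reflData lam ω).ρ j k| :=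
            mul_le_mul_of_nonneg_right (hcf lam hlam j x hx)
              (Finset.sum_nonneg fun k _ => abs_nonneg _)
        _ = Real.exp ε * (d.cfac j (xjv m j) x 0 * ∑ k, |(d.reflData 0 ω).ρ j k|) :=
            mul_assoc _ _ _
        _ ≤ Real.exp ε * (if (j : ℕ) < m then d.R0c else d.R1c) :=
            mul_le_mul_of_nonneg_left hr (Real.exp_pos _).le
        _ ≤ _ := by
            split_ifs <;> exact mul_le_mul_of_nonneg_left (by linarith) (Real.exp_pos _).le
    have hw : ∀ k, |(d.reflData lam ω).ρ j k| * (if (k : ℕ) < m then √K0 else √K1) =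
        |(d.reflData lam ω).ρ j k| * (if (j : ℕ) < m then √K1 else √K0) := fun k => by
      by_cases hj : (j : ℕ) < m <;> by_cases hk : (k : ℕ) < m
      · simp [reflData, hj, hk, hk.not_ge]
      · simp [hj, hk]
      · simp [hj, hk]
      · simp [reflData, hj, hk]
    simp only [hw]
    rw [abs_of_pos hpos, ← Finset.sum_mul, ← mul_assoc]
    have s0 := Real.mul_self_sqrt hK0p.le
    have s1 := Real.mul_self_sqrt hK1p.le
    split_ifs at hrow ⊢ with hj
    · calc _ ≤ K0 * √K1 := mul_le_mul_of_nonneg_right hrow (Real.sqrt_nonneg _)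
        _ = √K0 * √K1 * √K0 := by linear_combination -√K1 * s0
    · calc _ ≤ K1 * √K0 := mul_le_mul_of_nonneg_right hrow (Real.sqrt_nonneg _)
        _ = √K0 * √K1 * √K1 := by linear_combination -√K0 * s1

end HypData

/-- **`I − C(λ,ω)` is an isomorphism on `C_n` and on `C_n^1`, uniformly for
`λ ∈ [−δ₁,δ₁]`, `ω ∈ [−γ₁,γ₁]`.**  Assume `R₀R₁ < 1`.  Then for any `γ₁ > 0` there exist
`δ₁ ∈ (0,δ₀]` and `c₁ > 0` such that for all such `λ`, `ω` the equation `u = C(λ,ω)u + f`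
has, for every `f ∈ C_n`, a solution `u ∈ C_n` which satisfies `‖u‖_∞ ≤ c₁‖f‖_∞`, which is
the unique solution in `C_n`, and which belongs to `C_n^1` with `‖u‖_{C¹} ≤ c₁‖f‖_{C¹}`
whenever `f ∈ C_n^1`. -/
theorem I_minus_C_isomorphism {n m : ℕ} (d : HypData n m) (δ0 : ℝ)
    (hyp : d.StandingHyps δ0) (hdiss : d.R0c * d.R1c < 1) :
    ∀ γ1 > (0:ℝ), ∃ δ1 c1 : ℝ, 0 < δ1 ∧ δ1 ≤ δ0 ∧ 0 < c1 ∧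
      ∀ lam ∈ Set.Icc (-δ1) δ1, ∀ ω ∈ Set.Icc (-γ1) γ1,
        (∀ f : ℝ → ℝ → Fin n → ℝ, IsCnFun f →
          ∃ U : ℝ → ℝ → Fin n → ℝ, IsCnFun U ∧
            (∀ x ∈ Set.Icc (0:ℝ) 1, ∀ (t : ℝ) (j : Fin n),
              U x t j = d.CopRaw lam ω U x t j + f x t j) ∧
            supNorm U ≤ c1 * supNorm f ∧
            (IsCn1Fun f → IsCn1Fun U ∧ c1Norm U ≤ c1 * c1Norm f)) ∧
        (∀ U V : ℝ → ℝ → Fin n → ℝ, IsCnFun U → IsCnFun V →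
          (∀ x ∈ Set.Icc (0:ℝ) 1, ∀ (t : ℝ) (j : Fin n),
            U x t j - d.CopRaw lam ω U x t j = V x t j - d.CopRaw lam ω V x t j) →
          ∀ x ∈ Set.Icc (0:ℝ) 1, ∀ (t : ℝ) (j : Fin n), U x t j = V x t j) := by
  intro γ1 hγ1
  obtain ⟨δ1, hδ1, hδ10, w, q, hcon⟩ := hyp.exists_contr hdiss
  have hw : ∀ j, 0 < w j := (hcon 0 ⟨by linarith, hδ1.le⟩ 0).w_pos
  have hq : 0 < 1 - q := sub_pos.2 (hcon 0 ⟨by linarith, hδ1.le⟩ 0).q_lt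
  have : Nonempty (Fin n) := ⟨⟨0, hyp.1.trans hyp.2.1⟩⟩
  obtain ⟨j₀, hj₀⟩ := Finite.exists_min w
  obtain ⟨j₁, hj₁⟩ := Finite.exists_max w
  obtain ⟨G, hG⟩ := (isCompact_Icc.prod isCompact_Icc).exists_bound_of_continuousOn
    hyp.continuousOn_ratio
  obtain ⟨A, hA⟩ := (isCompact_Icc.prod isCompact_Icc).exists_bound_of_continuousOn
    hyp.continuousOn_inv_a
  have hmem : ((0:ℝ), (0:ℝ)) ∈ Set.Icc (0:ℝ) 1 ×ˢ Set.Icc (-δ0) δ0 :=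
    ⟨by simp, by linarith, by linarith⟩
  have hG0 : 0 ≤ G := (norm_nonneg _).trans (hG _ hmem)
  have hA0 : 0 ≤ A := (norm_nonneg _).trans (hA _ hmem)
  have hL0 : 0 < w j₁ / (w j₀ * (1 - q)) := div_pos (hw _) (mul_pos (hw _) hq)
  refine ⟨δ1, 1 + (1 + G + γ1 * A) * (w j₁ / (w j₀ * (1 - q))), hδ1, hδ10, by positivity,
    fun lam hlam ω hω => ?_⟩
  have hl : lam ∈ Set.Icc (-δ0) δ0 := ⟨by linarith [hlam.1], by linarith [hlam.2]⟩
  have h := hcon lam hlam ω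
  simp only [HypData.CopRaw_eq_op]
  refine ⟨fun f hf => ?_, fun U V hU hV hUV x hx t j => ?_⟩
  · obtain ⟨U, hU, hUe⟩ := h.exists_solution hf
    refine ⟨U, hU, hUe, supNorm_le (mul_nonneg (by positivity) (supNorm_nonneg f))
      fun x hx t j => ?_, fun hf1 => ?_⟩
    · calc |U x t j| ≤ supNorm f / (w j₀ * (1 - q)) * w j :=
            h.abs_solution_le (hw j₀) hj₀ hf hU hUe x hx t j
        _ ≤ supNorm f / (w j₀ * (1 - q)) * w j₁ := mul_le_mul_of_nonneg_left (hj₁ j)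
            (div_nonneg (supNorm_nonneg f) (mul_pos (hw _) hq).le)
        _ = w j₁ / (w j₀ * (1 - q)) * supNorm f := by ring
        _ ≤ _ := by
            refine mul_le_mul_of_nonneg_right ?_ (supNorm_nonneg f)
            nlinarith [mul_nonneg (add_nonneg hG0 (mul_nonneg hγ1.le hA0)) hL0.le]
    · have hda : ∀ j, ContinuousOn (fun x => d.dbu j j x lam / d.a j x lam) (Set.Icc 0 1) :=
        fun j => continuousOn_slice hyp.continuousOn_ratio j hl
      have hia : ∀ j, ContinuousOn (fun x => (d.a j x lam)⁻¹) (Set.Icc 0 1) :=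
        fun j => continuousOn_slice hyp.continuousOn_inv_a j hl
      refine h.isCn1Fun_solution (fun j x hx => hyp.hasDerivWithinAt_c hl ω j hx)
        (fun j x hx => hyp.hasDerivWithinAt_σ hl ω j hx)
        (fun j => (h.cont_c j).mul (hda j).neg)
        (fun j => continuousOn_const.mul (hia j).neg) hG0 (mul_nonneg hγ1.le hA0)
        (fun j x hx => ?_) (fun j x hx => ?_) (hw j₀) hj₀ (hw j₁).le hj₁ hf1 hU hUe
      · rw [abs_mul, abs_neg, mul_comm]
        exact mul_le_mul_of_nonneg_right ((norm_le_pi_norm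
          (fun l => d.dbu l l x lam / d.a l x lam) j).trans (hG (x, lam) ⟨hx, hl⟩)) (abs_nonneg _)
      · rw [abs_mul, abs_neg]
        exact mul_le_mul (abs_le.2 hω) ((norm_le_pi_norm
          (fun l => (d.a l x lam)⁻¹) j).trans (hA (x, lam) ⟨hx, hl⟩)) (abs_nonneg _) hγ1.le
  · obtain ⟨BU, hBU⟩ := hU.exists_bound
    obtain ⟨BV, hBV⟩ := hV.exists_bound
    have key := h.apriori (U := fun x t j => U x t j - V x t j)
      ⟨BU + BV, fun x hx t j => (abs_sub _ _).trans (add_le_add (hBU x hx t j) (hBV x hx t j))⟩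
      le_rfl (fun x hx t j => by
        rw [ReflData.op_sub, zero_mul]
        exact (abs_eq_zero.2 (by linarith [hUV x hx t j])).le) x hx t j
    rw [zero_div, zero_mul] at key
    exact sub_eq_zero.1 (abs_nonpos_iff.1 key)
end

section
/- For all λ ∈ [−δ_0,δ_0], ω ∈ ℝ, and all u ∈ C_n^1 satisfying the reflection boundary conditions u_j(0,t) = Σ_{k=m+1}^n r_{jk} u_k(0,t) for j = 1,…,m and u_j(1,t) = Σ_{k=1}^m r_{jk} u_k(1,t) for j = m+1,…,n, one has D(λ,ω)A(λ,ω)u = (I − C(λ,ω))u. -/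
open Real Set MeasureTheory Filter Topology

/-- The primitive of a function continuous on an interval is continuous there. -/
lemma continuousOn_primitive_Icc {f : ℝ → ℝ} {a b x : ℝ} (hf : ContinuousOn f (Icc a b))
    (hx : x ∈ Icc a b) : ContinuousOn (fun ξ => ∫ η in x..ξ, f η) (Icc a b) := by
  have hab : a ≤ b := hx.1.trans hx.2
  rw [← uIcc_of_le hab] at hf hx ⊢
  exact intervalIntegral.continuousOn_primitive_interval' hf.intervalIntegrable hx

/-- The primitive of a function continuous on `[a, b]` is differentiable in `(a, b)`. -/
lemma hasDerivAt_primitive_Ioo {f : ℝ → ℝ} {a b x ξ : ℝ} (hf : ContinuousOn f (Icc a b))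
    (hx : x ∈ Icc a b) (hξ : ξ ∈ Ioo a b) :
    HasDerivAt (fun ζ => ∫ η in x..ζ, f η) (f ξ) ξ := by
  refine intervalIntegral.integral_hasDerivAt_right
    (hf.mono (uIcc_subset_Icc hx (Ioo_subset_Icc_self hξ))).intervalIntegrable ?_
    (hf.continuousAt (Icc_mem_nhds hξ.1 hξ.2))
  exact (hf.mono Ioo_subset_Icc_self).stronglyMeasurableAtFilter isOpen_Ioo ξ hξ

/-- The linearized coefficients `∂_{u_k} b_j(·, λ, 0)` are continuous. -/
lemma HypData.continuous_dbu {n m : ℕ} (d : HypData n m) {j : Fin n}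
    (hb : ContDiff ℝ (⊤ : ℕ∞) (fun p : ℝ × ℝ × (Fin n → ℝ) => d.b j p.1 p.2.1 p.2.2))
    (k : Fin n) (lam : ℝ) : Continuous (fun x => d.dbu j k x lam) := by
  have h : ContDiff ℝ (⊤ : ℕ∞)
      (Function.uncurry fun (x : ℝ) (v : Fin n → ℝ) => d.b j x lam v) :=
    hb.comp (contDiff_fst.prodMk (contDiff_const.prodMk contDiff_snd))
  exact (ContDiff.fderiv_apply (n := 0) h contDiff_const contDiff_const
    (by norm_num)).continuous

/-- The chain rule for a `C¹` function along a curve `x ↦ (x, g x)` in the open strip. -/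
lemma IsCn1Fun.hasDerivAt_comp {n : ℕ} {U : ℝ → ℝ → Fin n → ℝ} (hU : IsCn1Fun U) (j : Fin n)
    {g : ℝ → ℝ} {g' x : ℝ} (hx : x ∈ Ioo (0:ℝ) 1) (hg : HasDerivAt g g' x) :
    HasDerivAt (fun y => U y (g y) j) (pdx U x (g x) j + g' * pdt U x (g x) j) x := by
  obtain ⟨-, hdiff, hcx, hct⟩ := hU
  have hstrip : ∀ᶠ v : ℝ × ℝ in 𝓝 (x, g x), v.1 ∈ Ioo (0:ℝ) 1 :=
    continuous_fst.continuousAt.eventually (isOpen_Ioo.mem_nhds hx)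
  have hnhds : Icc (0:ℝ) 1 ×ˢ (univ : Set ℝ) ∈ 𝓝 (x, g x) :=
    prod_mem_nhds (Icc_mem_nhds hx.1 hx.2) univ_mem
  have hcomp : ∀ {V : ℝ → ℝ → Fin n → ℝ},
      ContinuousOn (fun p : ℝ × ℝ => V p.1 p.2) (Icc 0 1 ×ˢ univ) →
      ContinuousAt (fun p : ℝ × ℝ => ContinuousLinearMap.toSpanSingleton ℝ (V p.1 p.2 j))
        (x, g x) := fun hV =>
    (ContinuousLinearMap.toSpanSingletonCLE (𝕜 := ℝ) (E := ℝ)).continuous.continuousAt.comp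
      ((continuous_apply j).continuousAt.comp (hV.continuousAt hnhds))
  have key := hasStrictFDerivAt_uncurry_coprod (𝕜 := ℝ) (u := (x, g x))
    (f := fun y s => U y s j)
    (f₁ := fun y s => ContinuousLinearMap.toSpanSingleton ℝ (pdx U y s j))
    (f₂ := fun y s => ContinuousLinearMap.toSpanSingleton ℝ (pdt U y s j))
    (hstrip.mono fun v hv =>
      ((hdiff j v.2 v.1 (Ioo_subset_Icc_self hv)).1.hasDerivWithinAt.hasDerivAt
        (Icc_mem_nhds hv.1 hv.2)).hasFDerivAt)
    (hstrip.mono fun v hv => (hdiff j v.2 v.1 (Ioo_subset_Icc_self hv)).2.hasDerivAt.hasFDerivAt)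
    (hcomp hcx) (hcomp hct)
  have h := key.hasFDerivAt.comp_hasDerivAt x ((hasDerivAt_id x).prodMk hg)
  simpa [Function.HasUncurry.uncurry, Function.comp_def] using h

/-- A continuous function on the strip is continuous along a continuous curve `x ↦ (x, g x)`. -/
lemma ContinuousOn.comp_graph {n : ℕ} {V : ℝ → ℝ → Fin n → ℝ}
    (hV : ContinuousOn (fun p : ℝ × ℝ => V p.1 p.2) (Icc 0 1 ×ˢ univ)) (j : Fin n)
    {g : ℝ → ℝ} (hg : ContinuousOn g (Icc 0 1)) :
    ContinuousOn (fun y => V y (g y) j) (Icc 0 1) :=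
  (continuous_apply j).comp_continuousOn
    (hV.comp (continuousOn_id.prodMk hg) fun _ hy => ⟨hy, mem_univ _⟩)

/-- Integration of `c_j (A u)_j / a_j` along a characteristic. -/
lemma HypData.integral_AopRaw_characteristic {n m : ℕ} (d : HypData n m) {lam : ℝ} (ω : ℝ)
    {U : ℝ → ℝ → Fin n → ℝ} (hU : IsCn1Fun U) {j : Fin n}
    (ha : ContinuousOn (fun x => d.a j x lam) (Icc 0 1))
    (hb : ContinuousOn (fun x => d.dbu j j x lam) (Icc 0 1))
    (ha0 : ∀ x ∈ Icc (0:ℝ) 1, d.a j x lam ≠ 0) {x y : ℝ} (hx : x ∈ Icc (0:ℝ) 1)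
    (hy : y ∈ Icc (0:ℝ) 1) (t : ℝ) :
    ∫ ξ in y..x, (d.cfac j ξ x lam / d.a j ξ lam) *
        d.AopRaw lam ω U ξ (d.tau j ξ x t lam ω) j =
      U x t j - d.cfac j y x lam * U y (d.tau j y x t lam ω) j := by
  have hinv : ContinuousOn (fun η => (d.a j η lam)⁻¹) (Icc 0 1) := ha.inv₀ ha0
  have hquot : ContinuousOn (fun η => d.dbu j j η lam / d.a j η lam) (Icc 0 1) := hb.div ha ha0
  have hτ : ContinuousOn (fun ξ => d.tau j ξ x t lam ω) (Icc 0 1) :=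
    (continuousOn_const.mul (continuousOn_primitive_Icc hinv hx)).add continuousOn_const
  have hc : ContinuousOn (fun ξ => d.cfac j ξ x lam) (Icc 0 1) :=
    Real.continuous_exp.comp_continuousOn (continuousOn_primitive_Icc hquot hx)
  have hUτ := hU.1.1.comp_graph j hτ
  have hsub : uIcc y x ⊆ Icc 0 1 := uIcc_subset_Icc hy hx
  have hint : ContinuousOn (fun ξ => (d.cfac j ξ x lam / d.a j ξ lam) *
      d.AopRaw lam ω U ξ (d.tau j ξ x t lam ω) j) (Icc 0 1) :=
    (hc.div ha ha0).mul (((continuousOn_const.mul (hU.2.2.2.comp_graph j hτ)).add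
      (ha.mul (hU.2.2.1.comp_graph j hτ))).add (hb.mul hUτ))
  rw [intervalIntegral.integral_eq_sub_of_hasDeriv_right
    (f := fun ξ => d.cfac j ξ x lam * U ξ (d.tau j ξ x t lam ω) j)
    ((hc.mul hUτ).mono hsub) (fun ξ hξ => ?_) (hint.mono hsub).intervalIntegrable]
  · simp [HypData.cfac, HypData.tau]
  · have hξ' : ξ ∈ Ioo (0:ℝ) 1 :=
      ⟨(le_min hy.1 hx.1).trans_lt hξ.1, hξ.2.trans_le (max_le hy.2 hx.2)⟩
    have hτ' : HasDerivAt (fun ζ => d.tau j ζ x t lam ω) (ω * (d.a j ξ lam)⁻¹) ξ :=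
      ((hasDerivAt_primitive_Ioo hinv hx hξ').const_mul ω).add_const t
    have hc' : HasDerivAt (fun ζ => d.cfac j ζ x lam)
        (d.cfac j ξ x lam * (d.dbu j j ξ lam / d.a j ξ lam)) ξ :=
      (hasDerivAt_primitive_Ioo hquot hx hξ').exp
    have hne := ha0 ξ (Ioo_subset_Icc_self hξ')
    refine ((hc'.mul (hU.hasDerivAt_comp j hξ' hτ')).congr_deriv ?_).hasDerivWithinAt
    simp only [HypData.AopRaw]
    field_simp
    ring

/-- **`D(λ,ω) A(λ,ω) u = (I − C(λ,ω)) u`** for all `u ∈ C_n^1` satisfying the reflection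
boundary conditions. -/
theorem D_A_identity {n m : ℕ} (d : HypData n m) (δ0 : ℝ)
    (hyp : d.StandingHyps δ0)
    (lam : ℝ) (hlam : lam ∈ Set.Icc (-δ0) δ0) (ω : ℝ)
    (U : ℝ → ℝ → Fin n → ℝ) (hU : IsCn1Fun U) (hbc : d.SatBC U) :
    ∀ x ∈ Set.Icc (0:ℝ) 1, ∀ (t : ℝ) (j : Fin n),
      d.DopRaw lam ω (d.AopRaw lam ω U) x t j = U x t j - d.CopRaw lam ω U x t j := by
  intro x hx t j
  obtain ⟨-, -, ha, hb, -, -, -, -, ha0⟩ := hyp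
  have hac : Continuous (fun x => d.a j x lam) :=
    (ha j).continuous.comp (continuous_id.prodMk continuous_const)
  have key : ∀ y ∈ Icc (0:ℝ) 1, _ := fun y hy =>
    d.integral_AopRaw_characteristic ω hU hac.continuousOn
      (d.continuous_dbu (hb j) j lam).continuousOn (fun x hx => ha0 j x hx lam hlam) hx hy t
  unfold HypData.DopRaw HypData.CopRaw xjv
  split_ifs with hj
  · rw [key 0 (by simp), (hbc _ j).1 hj]
  · rw [key 1 (by simp), (hbc _ j).2 (not_lt.1 hj)]
end
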